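/- arXiv:0807.4103 — 3 statements merged into one kernel-verified Lean document; each statement's English description precedes it below -/
import Mathlib

section
/- Let n ∈ ℕ be an odd number and let f : I → ℝ be an n-convex function on an interval I ⊆ ℝ. Then for any x₁ ∈ Int I there exists a polynomial p ∈ Πₙ such that p(x₁) = f(x₁) and p(x) ≤ f(x) for all x ∈ I. -/
/-- Divided differences of `f` at the points of a list, defined recursively:
`[x₁; f] = f x₁` and
`[x₁, …, x_{k+1}; f] = ([x₂, …, x_{k+1}; f] − [x₁, …, x_k; f]) / (x_{k+1} − x₁)`. -/
noncomputable def divDiff (f : ℝ → ℝ) : List ℝ → ℝ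
  | [] => 0
  | [x] => f x
  | x :: y :: l =>
      (divDiff f (y :: l) - divDiff f (x :: (y :: l).dropLast)) /
        ((y :: l).getLast (List.cons_ne_nil y l) - x)
termination_by l => l.length
decreasing_by
  all_goals simp [List.length_dropLast]

/-- A function `f` is `n`-convex on a set `I` if all its `(n+2)`-point divided
differences at distinct points of `I` are nonnegative. -/
def NConvexOn (n : ℕ) (I : Set ℝ) (f : ℝ → ℝ) : Prop :=
  ∀ l : List ℝ, l.length = n + 2 → l.Nodup → (∀ x ∈ l, x ∈ I) → 0 ≤ divDiff f l

open Filter Topology Lagrange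

/-- The divided difference of `f` at the points of a finite set, in its symmetric form. -/
noncomputable def finsetDivDiff (f : ℝ → ℝ) (s : Finset ℝ) : ℝ :=
  ∑ i ∈ s, nodalWeight s id i * f i

lemma nodalWeight_insert_of_mem {s : Finset ℝ} {a i : ℝ} (ha : a ∉ s) (hi : i ∈ s) :
    nodalWeight (insert a s) id i = (i - a)⁻¹ * nodalWeight s id i := by
  have hia : a ≠ i := fun h => ha (h ▸ hi)
  rw [nodalWeight, nodalWeight, Finset.erase_insert_of_ne hia,
    Finset.prod_insert (fun h => ha (Finset.mem_of_mem_erase h))]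
  simp

lemma nodalWeight_insert_self {s : Finset ℝ} {a : ℝ} (ha : a ∉ s) :
    nodalWeight (insert a s) id a = ∏ j ∈ s, (a - j)⁻¹ := by
  rw [nodalWeight, Finset.erase_insert ha]
  simp

lemma finsetDivDiff_insert (f : ℝ → ℝ) {s : Finset ℝ} {a : ℝ} (ha : a ∉ s) :
    finsetDivDiff f (insert a s) =
      (∏ j ∈ s, (a - j)⁻¹) * f a + ∑ i ∈ s, (i - a)⁻¹ * nodalWeight s id i * f i := by
  rw [finsetDivDiff, Finset.sum_insert ha, nodalWeight_insert_self ha]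
  congr 1
  exact Finset.sum_congr rfl fun i hi => by rw [nodalWeight_insert_of_mem ha hi]

lemma finsetDivDiff_insert_insert (f : ℝ → ℝ) {s : Finset ℝ} {a b : ℝ}
    (ha : a ∉ s) (hb : b ∉ s) (hab : a ≠ b) :
    finsetDivDiff f (insert a (insert b s)) * (b - a) =
      finsetDivDiff f (insert b s) - finsetDivDiff f (insert a s) := by
  have ha' : a ∉ insert b s := by simp [ha, hab]
  have h₁ : a - b ≠ 0 := sub_ne_zero.2 hab
  have h₂ : b - a ≠ 0 := sub_ne_zero.2 hab.symm
  rw [finsetDivDiff_insert f ha', finsetDivDiff_insert f hb, finsetDivDiff_insert f ha,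
    Finset.prod_insert hb, Finset.sum_insert hb, nodalWeight_insert_self hb]
  have hsum : (∑ i ∈ s, (i - a)⁻¹ * nodalWeight (insert b s) id i * f i) * (b - a) =
      ∑ i ∈ s, (i - b)⁻¹ * nodalWeight s id i * f i -
        ∑ i ∈ s, (i - a)⁻¹ * nodalWeight s id i * f i := by
    rw [Finset.sum_mul, ← Finset.sum_sub_distrib]
    refine Finset.sum_congr rfl fun i hi => ?_
    have h₃ : i - a ≠ 0 := sub_ne_zero.2 fun h => ha (h ▸ hi)
    have h₄ : i - b ≠ 0 := sub_ne_zero.2 fun h => hb (h ▸ hi)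
    rw [nodalWeight_insert_of_mem hb hi]
    field_simp
    ring
  have h₅ : (a - b)⁻¹ * (b - a) = -1 := by field_simp; ring
  have h₆ : (b - a)⁻¹ * (b - a) = 1 := inv_mul_cancel₀ h₂
  linear_combination hsum + (∏ j ∈ s, (a - j)⁻¹) * f a * h₅ + (∏ j ∈ s, (b - j)⁻¹) * f b * h₆

lemma divDiff_eq_finsetDivDiff (f : ℝ → ℝ) (l : List ℝ) (hl : l.Nodup) :
    divDiff f l = finsetDivDiff f l.toFinset := by
  induction hk : l.length using Nat.strong_induction_on generalizing l with
  | _ k ih =>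
    match l with
    | [] => simp [divDiff, finsetDivDiff]
    | [x] => simp [divDiff, finsetDivDiff, nodalWeight]
    | x :: y :: l =>
      obtain ⟨m, b, hm⟩ : ∃ m b, y :: l = m ++ [b] :=
        ⟨_, _, (List.dropLast_append_getLast (List.cons_ne_nil y l)).symm⟩
      rw [divDiff]
      simp only [hm, List.dropLast_concat, List.getLast_append_singleton] at hl hk ⊢
      have hxm : x ∉ m := fun h => by simp [h] at hl
      have hxb : x ≠ b := fun h => by simp [h] at hl
      have hm' : (m ++ [b]).Nodup := hl.of_cons
      have hbm : b ∉ m := fun h => by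
        rw [List.nodup_append] at hm'
        exact hm'.2.2 b h b (by simp) rfl
      have hmn : m.Nodup := hm'.of_append_left
      rw [ih (m ++ [b]).length (by simp [← hk]) _ hm' rfl,
        ih (x :: m).length (by simp [← hk]) _ (by simp [hxm, hmn]) rfl,
        div_eq_iff (sub_ne_zero.2 hxb.symm)]
      have h := finsetDivDiff_insert_insert f (s := m.toFinset) (a := x) (b := b)
        (by simpa using hxm) (by simpa using hbm) hxb
      have e : (m ++ [b]).toFinset = insert b m.toFinset := by ext; simp
      simp only [List.toFinset_cons, e]
      exact h.symm

lemma NConvexOn.finsetDivDiff_nonneg {n : ℕ} {I : Set ℝ} {f : ℝ → ℝ} (hf : NConvexOn n I f)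
    {s : Finset ℝ} (hs : s.card = n + 2) (hsI : ↑s ⊆ I) : 0 ≤ finsetDivDiff f s := by
  have h := hf s.toList (by simpa using hs) s.nodup_toList fun x hx => hsI (by simpa using hx)
  rwa [divDiff_eq_finsetDivDiff f _ s.nodup_toList, Finset.toList_toFinset] at h

lemma NConvexOn.finsetDivDiff_union_le {n : ℕ} {I : Set ℝ} {f : ℝ → ℝ} (hf : NConvexOn n I f)
    {s t u : Finset ℝ} (hst : s.card = t.card) (hlt : ∀ x ∈ s, ∀ y ∈ t, x < y)
    (hsu : Disjoint s u) (htu : Disjoint t u) (hcard : s.card + u.card = n + 1)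
    (hs : ↑s ⊆ I) (ht : ↑t ⊆ I) (hu : ↑u ⊆ I) :
    finsetDivDiff f (s ∪ u) ≤ finsetDivDiff f (t ∪ u) := by
  induction s using Finset.induction_on generalizing t u with
  | empty =>
    have : t = ∅ := by simpa using hst.symm
    rw [this]
  | insert a s ha ih =>
    obtain ⟨b, hb⟩ : t.Nonempty := by
      rw [← Finset.card_pos, ← hst, Finset.card_insert_of_notMem ha]; omega
    obtain ⟨t, hbt, rfl⟩ : ∃ t', b ∉ t' ∧ insert b t' = t :=
      ⟨t.erase b, by simp, Finset.insert_erase hb⟩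
    rw [Finset.card_insert_of_notMem ha] at hst hcard
    rw [Finset.card_insert_of_notMem hbt] at hst
    rw [Finset.disjoint_insert_left] at hsu htu
    have hab : a < b := hlt a (by simp) b (by simp)
    have hbs : b ∉ s := fun h => (hlt b (by simp [h]) b (by simp)).false
    rw [Finset.coe_insert, Set.insert_subset_iff] at hs ht
    have h₁ : finsetDivDiff f (insert a (s ∪ u)) ≤ finsetDivDiff f (insert b (s ∪ u)) := by
      have ha' : a ∉ s ∪ u := by simp [ha, hsu.1]
      have hb' : b ∉ s ∪ u := by simp [hbs, htu.1]
      have h := finsetDivDiff_insert_insert f ha' hb' hab.ne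
      have h₀ : 0 ≤ finsetDivDiff f (insert a (insert b (s ∪ u))) := by
        apply hf.finsetDivDiff_nonneg
        · rw [Finset.card_insert_of_notMem (by rw [Finset.mem_insert]; exact not_or.2 ⟨hab.ne, ha'⟩),
            Finset.card_insert_of_notMem hb', Finset.card_union_of_disjoint hsu.2]
          omega
        · simp only [Finset.coe_insert, Finset.coe_union, Set.insert_subset_iff,
            Set.union_subset_iff]
          exact ⟨hs.1, ht.1, hs.2, hu⟩
      nlinarith [mul_nonneg h₀ (sub_pos.2 hab).le]
    have h₂ := ih (t := t) (u := insert b u) (by omega)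
      (fun x hx y hy => hlt x (by simp [hx]) y (by simp [hy]))
      (by rw [Finset.disjoint_insert_right]; exact ⟨hbs, hsu.2⟩)
      (by rw [Finset.disjoint_insert_right]; exact ⟨hbt, htu.2⟩)
      (by rw [Finset.card_insert_of_notMem htu.1]; omega) hs.2 ht.2
      (by rw [Finset.coe_insert, Set.insert_subset_iff]; exact ⟨ht.1, hu⟩)
    rw [Finset.insert_union, Finset.insert_union]
    rw [Finset.union_insert, Finset.union_insert] at h₂
    exact h₁.trans h₂

/-- For an `n`-convex function, divided differences at `n + 1` points increase when all the
points move to the right. -/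
lemma NConvexOn.finsetDivDiff_le {n : ℕ} {I : Set ℝ} {f : ℝ → ℝ} (hf : NConvexOn n I f)
    {s t : Finset ℝ} (hs : s.card = n + 1) (ht : t.card = n + 1)
    (hlt : ∀ x ∈ s, ∀ y ∈ t, x < y) (hsI : ↑s ⊆ I) (htI : ↑t ⊆ I) :
    finsetDivDiff f s ≤ finsetDivDiff f t := by
  simpa using hf.finsetDivDiff_union_le (u := ∅) (hs.trans ht.symm) hlt (by simp) (by simp)
    (by simpa using hs) hsI htI (by simp)

lemma sub_eval_interpolate (f : ℝ → ℝ) {s : Finset ℝ} {x : ℝ} (hx : x ∉ s) :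
    f x - (interpolate s id f).eval x = finsetDivDiff f (insert x s) * ∏ i ∈ s, (x - i) := by
  have hne : ∀ i ∈ s, x ≠ id i := fun i hi h => hx (by simpa [h] using hi)
  have hprod : (∏ j ∈ s, (x - j)⁻¹) * ∏ i ∈ s, (x - i) = 1 := by
    rw [← Finset.prod_mul_distrib]
    exact Finset.prod_eq_one fun i hi => inv_mul_cancel₀ (sub_ne_zero.2 (hne i hi))
  have hsum : ∑ i ∈ s, (i - x)⁻¹ * nodalWeight s id i * f i =
      -∑ i ∈ s, nodalWeight s id i * (x - id i)⁻¹ * f i := by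
    rw [← Finset.sum_neg_distrib]
    refine Finset.sum_congr rfl fun i hi => ?_
    rw [← neg_sub x i, inv_neg, id]
    ring
  rw [eval_interpolate_not_at_node f hne, eval_nodal, finsetDivDiff_insert f hx, hsum]
  simp only [id]
  linear_combination -f x * hprod

lemma prod_sub_nonneg_of_even_card {s : Finset ℝ} (hs : Even s.card) {x : ℝ}
    (hx : ∀ i ∈ s, x ≤ i) : 0 ≤ ∏ i ∈ s, (x - i) := by
  have h : ∏ i ∈ s, (x - i) = ∏ i ∈ s, (i - x) := by
    rw [← mul_one (∏ i ∈ s, (i - x)), ← hs.neg_one_pow, ← Finset.prod_const,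
      ← Finset.prod_mul_distrib]
    exact Finset.prod_congr rfl fun i _ => by ring
  rw [h]
  exact Finset.prod_nonneg fun i hi => sub_nonneg.2 (hx i hi)

lemma NConvexOn.eval_interpolate_le {n : ℕ} {I : Set ℝ} {f : ℝ → ℝ} (hf : NConvexOn n I f)
    {s : Finset ℝ} (hs : s.card = n + 1) (hsI : ↑s ⊆ I) {x : ℝ} (hx : x ∈ I) (hxs : x ∉ s)
    (hprod : 0 ≤ ∏ i ∈ s, (x - i)) : (interpolate s id f).eval x ≤ f x := by
  have h : 0 ≤ finsetDivDiff f (insert x s) :=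
    hf.finsetDivDiff_nonneg (by rw [Finset.card_insert_of_notMem hxs, hs])
      (by rw [Finset.coe_insert, Set.insert_subset_iff]; exact ⟨hx, hsI⟩)
  linarith [sub_eval_interpolate f hxs, mul_nonneg h hprod]

lemma exists_finset_card_subset_Ioo {a b : ℝ} (hab : a < b) (n : ℕ) :
    ∃ s : Finset ℝ, ↑s ⊆ Set.Ioo a b ∧ s.card = n :=
  (Set.Ioo_infinite hab).exists_subset_card_eq n

/-- Polynomials of degree at most `n` that are bounded at `n + 1` points converge pointwise along
any ultrafilter to a polynomial of degree at most `n`. -/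
lemma exists_tendsto_eval_of_bounded {n : ℕ} {ι : Type*} (U : Ultrafilter ι)
    {p : ι → Polynomial ℝ} (hp : ∀ m, (p m).degree < (n + 1 : ℕ)) {s : Finset ℝ}
    (hs : s.card = n + 1) {a b : ℝ → ℝ} (hab : ∀ y ∈ s, ∀ m, (p m).eval y ∈ Set.Icc (a y) (b y)) :
    ∃ q : Polynomial ℝ, q.natDegree ≤ n ∧
      ∀ x, Tendsto (fun m => (p m).eval x) U (𝓝 (q.eval x)) := by
  have hlim : ∀ y, ∃ c, y ∈ s → Tendsto (fun m => (p m).eval y) U (𝓝 c) := by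
    intro y
    by_cases hy : y ∈ s
    · obtain ⟨c, -, hc⟩ := (isCompact_Icc (a := a y) (b := b y)).ultrafilter_le_nhds
        (U.map fun m => (p m).eval y) (by
          rw [le_principal_iff]
          exact Filter.mem_map.2 (Filter.univ_mem' fun m => hab y hy m))
      exact ⟨c, fun _ => hc⟩
    · exact ⟨0, fun h => absurd h hy⟩
  choose c hc using hlim
  refine ⟨interpolate s id c, ?_, fun x => ?_⟩
  · have h := degree_interpolate_lt c (Function.injective_id.injOn (s := (s : Set ℝ)))
    rw [hs] at h
    exact Polynomial.natDegree_le_iff_coeff_eq_zero.2 fun N hN =>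
      (Polynomial.degree_lt_iff_coeff_zero _ _).1 h N hN
  · have h : ∀ m, (p m).eval x = ∑ y ∈ s, (p m).eval y * (Lagrange.basis s id y).eval x := by
      intro m
      conv_lhs => rw [eq_interpolate (f := p m)
        (Function.injective_id.injOn (s := (s : Set ℝ))) (by rw [hs]; exact hp m)]
      simp [interpolate_apply, Polynomial.eval_finsetSum]
    simp only [h, interpolate_apply, Polynomial.eval_finsetSum, Polynomial.eval_mul,
      Polynomial.eval_C]
    exact tendsto_finsetSum _ fun y hy => (hc y hy).mul_const _

/-- Corollary 1 (support theorem): an `n`-convex function with `n` odd admits at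
every interior point a polynomial support of degree at most `n`. -/
theorem support_theorem_odd_order
    (n : ℕ) (hn : Odd n) (I : Set ℝ) (hI : I.OrdConnected)
    (f : ℝ → ℝ) (hf : NConvexOn n I f)
    (x₁ : ℝ) (hx₁ : x₁ ∈ interior I) :
    ∃ p : Polynomial ℝ, p.natDegree ≤ n ∧ p.eval x₁ = f x₁ ∧
      ∀ x ∈ I, p.eval x ≤ f x := by
  obtain ⟨ε, hε, hball⟩ := Metric.mem_nhds_iff.1 (mem_interior_iff_mem_nhds.1 hx₁)
  rw [Real.ball_eq_Ioo] at hball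
  have hmem : ∀ {x}, x₁ - ε < x → x < x₁ + ε → x ∈ I := fun h₁ h₂ => hball ⟨h₁, h₂⟩
  obtain ⟨Z, hZ, hZc⟩ :=
    exists_finset_card_subset_Ioo (show x₁ - ε < x₁ - ε / 2 by linarith) (n + 1)
  obtain ⟨Y, hY, hYc⟩ := exists_finset_card_subset_Ioo (show x₁ - ε / 2 < x₁ by linarith) (n + 1)
  obtain ⟨W, hW, hWc⟩ :=
    exists_finset_card_subset_Ioo (show x₁ + ε / 2 < x₁ + ε by linarith) (n + 1)
  have hδ : ∀ m : ℕ, 0 < ε / 2 * (1 / ((m : ℝ) + 1)) := fun m => by positivity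
  have hδε : ∀ m : ℕ, ε / 2 * (1 / ((m : ℝ) + 1)) ≤ ε / 2 := fun m =>
    mul_le_of_le_one_right (by positivity) ((div_le_one (by positivity)).2 (by simp))
  have hδ₀ : Tendsto (fun m : ℕ => x₁ + ε / 2 * (1 / ((m : ℝ) + 1))) atTop (𝓝 x₁) := by
    simpa using (tendsto_one_div_add_atTop_nhds_zero_nat.const_mul (ε / 2)).const_add x₁
  choose T hT hTc using fun m : ℕ =>
    exists_finset_card_subset_Ioo (show x₁ < x₁ + ε / 2 * (1 / ((m : ℝ) + 1)) by
      linarith [hδ m]) n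
  have hTlt : ∀ m, ∀ i ∈ T m, x₁ < i ∧ i < x₁ + ε / 2 := fun m i hi =>
    ⟨(hT m hi).1, (hT m hi).2.trans_le (by linarith [hδε m])⟩
  have hx₁T : ∀ m, x₁ ∉ T m := fun m h => (hTlt m _ h).1.false
  have hSc : ∀ m, (insert x₁ (T m)).card = n + 1 := fun m => by
    rw [Finset.card_insert_of_notMem (hx₁T m), hTc]
  have hS : ∀ m, ∀ i ∈ insert x₁ (T m), x₁ ≤ i ∧ i < x₁ + ε / 2 := fun m i hi => by
    rcases Finset.mem_insert.1 hi with rfl | hi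
    · exact ⟨le_rfl, by linarith⟩
    · exact ⟨(hTlt m i hi).1.le, (hTlt m i hi).2⟩
  have hSI : ∀ m, ((insert x₁ (T m) : Finset ℝ) : Set ℝ) ⊆ I := fun m i hi =>
    hmem (by linarith [(hS m i hi).1]) (by linarith [(hS m i hi).2])
  have hZI : ↑Z ⊆ I := fun i hi => hmem (hZ hi).1 (by linarith [(hZ hi).2])
  have hWI : ↑W ⊆ I := fun i hi => hmem (by linarith [(hW hi).1]) (hW hi).2
  have heven : ∀ m, Even (insert x₁ (T m)).card := fun m => by rw [hSc]; exact hn.add_one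
  have hleft : ∀ x ∈ I, x < x₁ → ∀ m, (interpolate (insert x₁ (T m)) id f).eval x ≤ f x :=
    fun x hx hlt m => hf.eval_interpolate_le (hSc m) (hSI m) hx
      (fun h => (hlt.trans_le (hS m x h).1).false)
      (prod_sub_nonneg_of_even_card (heven m) fun i hi => hlt.le.trans (hS m i hi).1)
  have hlow : ∀ y ∈ Y, ∀ m,
      f y - (finsetDivDiff f W - finsetDivDiff f Z) / (x₁ - y) * ε ^ (n + 1) ≤
        (interpolate (insert x₁ (T m)) id f).eval y := by
    intro y hy m
    have hy₁ := (hY hy).1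
    have hy₂ : y < x₁ := (hY hy).2
    have hyT : y ∉ T m := fun h => (hy₂.trans (hTlt m y h).1).false
    have hyS : y ∉ insert x₁ (T m) := fun h => (hy₂.trans_le (hS m y h).1).false
    have hyI : y ∈ I := hmem (by linarith) (by linarith)
    have hW' : finsetDivDiff f (insert x₁ (T m)) ≤ finsetDivDiff f W :=
      hf.finsetDivDiff_le (hSc m) hWc (fun i hi j hj => (hS m i hi).2.trans (hW hj).1)
        (hSI m) hWI
    have hZ' : finsetDivDiff f Z ≤ finsetDivDiff f (insert y (T m)) := by
      refine hf.finsetDivDiff_le hZc (by rw [Finset.card_insert_of_notMem hyT, hTc])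
        (fun i hi j hj => ?_) hZI fun i hi => ?_
      · rcases Finset.mem_insert.1 hj with rfl | hj
        · exact (hZ hi).2.trans hy₁
        · linarith [(hZ hi).2, (hTlt m j hj).1]
      · rcases Finset.mem_insert.1 hi with rfl | hi
        · exact hyI
        · exact hSI m (Finset.mem_insert_of_mem hi)
    have hD : finsetDivDiff f (insert y (insert x₁ (T m))) ≤
        (finsetDivDiff f W - finsetDivDiff f Z) / (x₁ - y) := by
      rw [le_div_iff₀ (sub_pos.2 hy₂), finsetDivDiff_insert_insert f hyT (hx₁T m) hy₂.ne]
      linarith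
    have hD₀ : 0 ≤ finsetDivDiff f (insert y (insert x₁ (T m))) :=
      hf.finsetDivDiff_nonneg (by rw [Finset.card_insert_of_notMem hyS, hSc])
        (by rw [Finset.coe_insert, Set.insert_subset_iff]; exact ⟨hyI, hSI m⟩)
    have hprod : ∏ i ∈ insert x₁ (T m), (y - i) ≤ ε ^ (n + 1) := by
      refine (le_abs_self _).trans ?_
      rw [Finset.abs_prod, ← hSc m, ← Finset.prod_const]
      refine Finset.prod_le_prod (fun i _ => abs_nonneg _) fun i hi => abs_le.2 ?_
      constructor <;> linarith [(hS m i hi).1, (hS m i hi).2]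
    have := mul_le_mul hD hprod (prod_sub_nonneg_of_even_card (heven m) fun i hi =>
      hy₂.le.trans (hS m i hi).1) (hD₀.trans hD)
    linarith [sub_eval_interpolate f hyS]
  obtain ⟨q, hq, hlim⟩ := exists_tendsto_eval_of_bounded (hyperfilter ℕ)
    (p := fun m => interpolate (insert x₁ (T m)) id f)
    (fun m => by
      have h := degree_interpolate_lt f
        (Function.injective_id.injOn (s := ((insert x₁ (T m) : Finset ℝ) : Set ℝ)))
      rwa [hSc] at h) hYc
    (fun y hy m => ⟨hlow y hy m, hleft y (hmem (by linarith [(hY hy).1])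
      (by linarith [(hY hy).2])) (hY hy).2 m⟩)
  have hq₁ : q.eval x₁ = f x₁ := by
    refine tendsto_nhds_unique (hlim x₁) (tendsto_const_nhds.congr fun m => ?_)
    exact (eval_interpolate_at_node (v := id) f Function.injective_id.injOn
      (Finset.mem_insert_self x₁ (T m))).symm
  refine ⟨q, hq, hq₁, fun x hx => ?_⟩
  rcases lt_trichotomy x x₁ with h | rfl | h
  · exact le_of_tendsto (hlim x) (Eventually.of_forall (hleft x hx h))
  · exact hq₁.le
  · refine le_of_tendsto (hlim x) ?_
    have hev := (hδ₀.eventually_lt_const h).filter_mono Nat.hyperfilter_le_atTop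
    filter_upwards [hev] with m hm
    have hlt : ∀ i ∈ insert x₁ (T m), i < x := fun i hi => by
      rcases Finset.mem_insert.1 hi with rfl | hi
      · exact h
      · exact (hT m hi).2.trans hm
    exact hf.eval_interpolate_le (hSc m) (hSI m) hx (fun h' => (hlt x h').false)
      (Finset.prod_nonneg fun i hi => sub_nonneg.2 (hlt i hi).le)
end

section
/- Let n ∈ ℕ, n ≥ 1. If f : [a, b] → ℝ is (2n−1)-convex and x₁ < x₂ < … < x_n are points of the open interval (a, b), then there exists a polynomial p ∈ Π_{2n−1} such that p(x_i) = f(x_i) for i = 1, …, n, and p(x) ≤ f(x) for all x ∈ [a, b]. -/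
open Polynomial Filter Topology

lemma divDiff_cons_append_singleton (f : ℝ → ℝ) (x z : ℝ) (m : List ℝ) :
    divDiff f (x :: (m ++ [z])) =
      (divDiff f (m ++ [z]) - divDiff f (x :: m)) / (z - x) := by
  rcases hm : m ++ [z] with _ | ⟨y, l⟩
  · simp at hm
  · rw [divDiff]
    simp only [← hm, List.dropLast_concat, List.getLast_append_singleton]

/-- The divided difference at `k + 1` distinct points is the coefficient of degree `k` of an
interpolating polynomial. -/
lemma exists_interpolant_coeff_eq_divDiff (f : ℝ → ℝ) (k : ℕ) (l : List ℝ)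
    (hl : l.length = k + 1) (hnd : l.Nodup) :
    ∃ q : ℝ[X], q.natDegree ≤ k ∧ (∀ t ∈ l, q.eval t = f t) ∧ q.coeff k = divDiff f l := by
  induction k generalizing l with
  | zero =>
    obtain ⟨x, rfl⟩ := List.length_eq_one_iff.mp hl
    exact ⟨C (f x), by simp, by simp, by simp [divDiff]⟩
  | succ k ih =>
    obtain _ | ⟨x, l⟩ := l
    · simp at hl
    obtain rfl | ⟨m, z, rfl⟩ := List.eq_nil_or_concat l
    · simp at hl
    simp only [List.concat_eq_append] at *
    have hlen : m.length = k := by simpa using hl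
    have hnd' := List.nodup_cons.mp hnd
    have hnm : (x :: m).Nodup := by
      rw [← List.cons_append] at hnd
      exact (List.nodup_append.mp hnd).1
    have hxz : z - x ≠ 0 := by
      have := hnd'.1
      simp only [List.mem_append, List.mem_singleton, not_or] at this
      exact sub_ne_zero.mpr (Ne.symm this.2)
    obtain ⟨q₁, hd₁, he₁, hc₁⟩ := ih (m ++ [z]) (by simp [hlen]) hnd'.2
    obtain ⟨q₂, hd₂, he₂, hc₂⟩ := ih (x :: m) (by simp [hlen]) hnm
    have hz₁ : q₁.coeff (k + 1) = 0 := coeff_eq_zero_of_natDegree_lt (by omega)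
    have hz₂ : q₂.coeff (k + 1) = 0 := coeff_eq_zero_of_natDegree_lt (by omega)
    refine ⟨C (z - x)⁻¹ * ((X - C x) * q₁ - (X - C z) * q₂), ?_, ?_, ?_⟩
    · refine (natDegree_C_mul_le _ _).trans ((natDegree_sub_le _ _).trans (max_le ?_ ?_)) <;>
      · refine natDegree_mul_le.trans ?_
        rw [natDegree_X_sub_C]
        omega
    · intro t ht
      simp only [eval_mul, eval_sub, eval_C, eval_X]
      rw [inv_mul_eq_iff_eq_mul₀ hxz]
      by_cases h₁ : t = x
      · subst h₁
        rw [he₂ t (by simp)]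
        ring
      by_cases h₂ : t = z
      · subst h₂
        rw [he₁ t (by simp)]
        ring
      have htm : t ∈ m := by simpa [h₁, h₂] using ht
      rw [he₁ t (by simp [htm]), he₂ t (by simp [htm])]
      ring
    · rw [divDiff_cons_append_singleton, ← hc₁, ← hc₂]
      simp only [coeff_C_mul, sub_mul, coeff_sub, coeff_X_mul, hz₁, hz₂]
      field_simp
      ring

/-- The symmetric formula for divided differences at the points of an injective family. -/
lemma divDiff_map_toList {κ : Type*} [Fintype κ] [DecidableEq κ] [Nonempty κ] (f : ℝ → ℝ)
    {v : κ → ℝ} (hv : Function.Injective v) :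
    divDiff f (Finset.univ.toList.map v) =
      ∑ k, f (v k) / ∏ j ∈ Finset.univ.erase k, (v k - v j) := by
  have hcard : Fintype.card κ = Fintype.card κ - 1 + 1 :=
    (Nat.succ_pred_eq_of_pos Fintype.card_pos).symm
  obtain ⟨q, hd, he, hc⟩ := exists_interpolant_coeff_eq_divDiff f (Fintype.card κ - 1)
    (Finset.univ.toList.map v) (by simpa using hcard)
    ((Finset.nodup_toList _).map hv)
  have hdeg : q.degree < (Finset.univ : Finset κ).card := by
    refine degree_le_natDegree.trans_lt ?_
    rw [Finset.card_univ]
    exact_mod_cast (by omega : q.natDegree < Fintype.card κ)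
  rw [← hc, ← Finset.card_univ, Lagrange.coeff_eq_sum hv.injOn hdeg]
  refine Finset.sum_congr rfl fun k _ => ?_
  rw [he (v k) (List.mem_map_of_mem (by simp))]

lemma NConvexOn.sum_nonneg {κ : Type*} [Fintype κ] [DecidableEq κ] {m : ℕ} {I : Set ℝ}
    {f : ℝ → ℝ} (hf : NConvexOn m I f) (hκ : Fintype.card κ = m + 2)
    {v : κ → ℝ} (hv : Function.Injective v) (hvI : ∀ k, v k ∈ I) :
    0 ≤ ∑ k, f (v k) / ∏ j ∈ Finset.univ.erase k, (v k - v j) := by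
  have : Nonempty κ := Fintype.card_pos_iff.mp (by omega)
  rw [← divDiff_map_toList f hv]
  refine hf _ (by simpa using hκ) ((Finset.nodup_toList _).map hv) ?_
  simpa using hvI

lemma sum_eval_div_prod_eq_zero {κ : Type*} [Fintype κ] [DecidableEq κ] {p : ℝ[X]}
    (hp : p.natDegree + 2 ≤ Fintype.card κ) {v : κ → ℝ} (hv : Function.Injective v) :
    ∑ k, p.eval (v k) / ∏ j ∈ Finset.univ.erase k, (v k - v j) = 0 := by
  have hdeg : p.degree < (Finset.univ : Finset κ).card := by
    refine degree_le_natDegree.trans_lt ?_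
    rw [Finset.card_univ]
    exact_mod_cast (by omega : p.natDegree < Fintype.card κ)
  rw [← Lagrange.coeff_eq_sum hv.injOn hdeg]
  exact coeff_eq_zero_of_natDegree_lt (by rw [Finset.card_univ]; omega)

/-- The nodes `x i` together with their translates by `h`. -/
def doubledNodes {ι : Type*} (x : ι → ℝ) (h : ℝ) : ι ⊕ ι → ℝ :=
  Sum.elim x fun i => x i + h

/-- The doubled nodes together with one further point `y`. -/
def augmentedNodes {ι : Type*} (x : ι → ℝ) (h y : ℝ) : Option (ι ⊕ ι) → ℝ
  | none => y
  | some k => doubledNodes x h k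

lemma doubledNodes_injective {ι : Type*} {x : ι → ℝ} (hx : Function.Injective x) {h : ℝ}
    (h0 : 0 < h) (hgap : ∀ i j, x i < x j → x i + h < x j) :
    Function.Injective (doubledNodes x h) := by
  have key : ∀ i j, x i ≠ x j + h := fun i j hij => by
    have := hgap j i (by linarith)
    linarith
  rintro (i | i) (j | j) hij <;> simp only [doubledNodes, Sum.elim_inl, Sum.elim_inr] at hij
  · rw [hx hij]
  · exact (key _ _ hij).elim
  · exact (key _ _ hij.symm).elim
  · rw [hx (add_right_cancel hij)]

lemma augmentedNodes_injective {ι : Type*} {x : ι → ℝ} (hx : Function.Injective x) {h y : ℝ}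
    (h0 : 0 < h) (hgap : ∀ i j, x i < x j → x i + h < x j)
    (hy : ∀ i, 0 < (y - x i) * (y - (x i + h))) :
    Function.Injective (augmentedNodes x h y) := by
  have key : ∀ k, y ≠ doubledNodes x h k := by
    rintro (i | i) hk <;> have := hy i <;> simp [doubledNodes] at hk <;> simp [hk] at this
  rintro (_ | i) (_ | j) hij
  · rfl
  · exact (key _ hij).elim
  · exact (key _ hij.symm).elim
  · rw [doubledNodes_injective hx h0 hgap hij]

lemma prod_erase_univ_eq_prod_ite {κ : Type*} [Fintype κ] [DecidableEq κ] (k : κ) (g : κ → ℝ) :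
    ∏ j ∈ Finset.univ.erase k, g j = ∏ j, if j = k then 1 else g j := by
  rw [← Finset.prod_erase (f := fun j => if j = k then 1 else g j) Finset.univ (if_pos rfl)]
  exact Finset.prod_congr rfl fun j hj => (if_neg (Finset.ne_of_mem_erase hj)).symm

section

variable {ι : Type*} [Fintype ι] {x : ι → ℝ} {h y a b : ℝ} {f : ℝ → ℝ}

lemma eventually_translates_separated (x : ι → ℝ) :
    ∀ᶠ h in 𝓝[>] (0 : ℝ), ∀ i j, x i < x j → x i + h < x j := by
  refine eventually_all.2 fun i => eventually_all.2 fun j => ?_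
  by_cases hij : x i < x j
  · filter_upwards [Ioo_mem_nhdsGT (sub_pos.mpr hij)] with h hh _
    linarith [hh.2]
  · exact Eventually.of_forall fun h hlt => (hij hlt).elim

lemma eventually_doubledNodes_mem_Icc (hxI : ∀ i, x i ∈ Set.Ioo a b) :
    ∀ᶠ h in 𝓝[>] (0 : ℝ), ∀ k, doubledNodes x h k ∈ Set.Icc a b := by
  have : ∀ᶠ h in 𝓝[>] (0 : ℝ), ∀ i, h ∈ Set.Ioo 0 (b - x i) :=
    eventually_all.2 fun i => Ioo_mem_nhdsGT (sub_pos.mpr (hxI i).2)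
  filter_upwards [this] with h hh
  rintro (i | i) <;> simp only [doubledNodes, Sum.elim_inl, Sum.elim_inr, Set.mem_Icc]
  · exact ⟨(hxI i).1.le, (hxI i).2.le⟩
  · constructor <;> linarith [(hh i).1, (hh i).2, (hxI i).1]

lemma eventually_forall_mul_pos (hy : ∀ i, y ≠ x i) :
    ∀ᶠ h in 𝓝[>] (0 : ℝ), ∀ i, 0 < (y - x i) * (y - (x i + h)) := by
  refine eventually_all.2 fun i => ?_
  have hc : Tendsto (fun h : ℝ => (y - x i) * (y - (x i + h))) (𝓝[>] 0)
      (𝓝 ((y - x i) * (y - (x i + 0)))) :=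
    (Continuous.tendsto (by fun_prop) 0).mono_left nhdsWithin_le_nhds
  refine hc.eventually_const_lt ?_
  rw [add_zero]
  exact mul_self_pos.mpr (sub_ne_zero.mpr (hy i))

variable [DecidableEq ι]

lemma prod_augmentedNodes_none_pos (hy : ∀ i, 0 < (y - x i) * (y - (x i + h))) :
    0 < ∏ j ∈ Finset.univ.erase none,
      (augmentedNodes x h y none - augmentedNodes x h y j) := by
  have : ∏ j ∈ Finset.univ.erase none,
      (augmentedNodes x h y none - augmentedNodes x h y j) =
      ∏ i, (y - x i) * (y - (x i + h)) := by
    rw [Finset.prod_mul_distrib, prod_erase_univ_eq_prod_ite, Fintype.prod_option,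
      Fintype.prod_sum_type]
    simp [augmentedNodes, doubledNodes]
  rw [this]
  exact Finset.prod_pos fun i _ => hy i

lemma prod_augmentedNodes_inr_pos (hx : Function.Injective x) (h0 : 0 < h)
    (hgap : ∀ i j, x i < x j → x i + h < x j) (hy : ∀ i, y < x i) (i : ι) :
    0 < ∏ j ∈ Finset.univ.erase (some (Sum.inr i)),
      (augmentedNodes x h y (some (Sum.inr i)) - augmentedNodes x h y j) := by
  have : ∏ j ∈ Finset.univ.erase (some (Sum.inr i)),
      (augmentedNodes x h y (some (Sum.inr i)) - augmentedNodes x h y j) =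
      (x i + h - y) * ∏ j, (x i + h - x j) * (if j = i then 1 else x i + h - (x j + h)) := by
    rw [Finset.prod_mul_distrib, prod_erase_univ_eq_prod_ite, Fintype.prod_option,
      Fintype.prod_sum_type]
    simp [augmentedNodes, doubledNodes]
  rw [this]
  refine mul_pos (by linarith [hy i]) (Finset.prod_pos fun j _ => ?_)
  split_ifs with hji
  · subst hji
    simpa using h0
  · rcases lt_or_gt_of_ne (fun e => hji (hx e)) with hlt | hlt
    · exact mul_pos (by linarith) (by linarith)
    · have := hgap i j hlt
      exact mul_pos_of_neg_of_neg (by linarith) (by linarith)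

/-- A polynomial interpolating at the doubled nodes lies below the function at every point
outside the short intervals between a node and its translate. -/
lemma NConvexOn.eval_le_of_interpolates [Nonempty ι]
    (hf : NConvexOn (2 * Fintype.card ι - 1) (Set.Icc a b) f)
    (hx : Function.Injective x) (h0 : 0 < h) (hgap : ∀ i j, x i < x j → x i + h < x j)
    (hxI : ∀ k, doubledNodes x h k ∈ Set.Icc a b) {p : ℝ[X]}
    (hp : p.natDegree ≤ 2 * Fintype.card ι - 1)
    (hpf : ∀ k, p.eval (doubledNodes x h k) = f (doubledNodes x h k))
    (hyI : y ∈ Set.Icc a b) (hy : ∀ i, 0 < (y - x i) * (y - (x i + h))) :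
    p.eval y ≤ f y := by
  have hpos : 0 < Fintype.card ι := Fintype.card_pos
  have hcard : Fintype.card (Option (ι ⊕ ι)) = 2 * Fintype.card ι - 1 + 2 := by
    simp only [Fintype.card_option, Fintype.card_sum]
    omega
  have hinj := augmentedNodes_injective hx h0 hgap hy
  have hs := hf.sum_nonneg hcard hinj (by rintro (_ | k); exacts [hyI, hxI k])
  have hz := sum_eval_div_prod_eq_zero (p := p) (by omega) hinj
  have hw := prod_augmentedNodes_none_pos hy
  rw [← hz, Fintype.sum_option, Fintype.sum_option] at hs
  simp only [augmentedNodes, hpf, add_le_add_iff_right] at hs hw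
  exact (div_le_div_iff_of_pos_right hw).mp hs

/-- Polynomials of degree at most `2n - 1` with prescribed values at the `n` nodes that are
bounded above at the translated nodes and at a point to the left of all nodes are bounded below
at the translated nodes. -/
lemma exists_lower_bound_at_translates [Nonempty ι]
    (hx : Function.Injective x) (h0 : 0 < h) (hgap : ∀ i j, x i < x j → x i + h < x j)
    (hy : ∀ i, y < x i) (i : ι) (f : ℝ → ℝ) :
    ∃ M, ∀ p : ℝ[X], p.natDegree ≤ 2 * Fintype.card ι - 1 →
      (∀ j, p.eval (x j) = f (x j)) → (∀ j, p.eval (x j + h) ≤ f (x j + h)) →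
      p.eval y ≤ f y → M ≤ p.eval (x i + h) := by
  have hpos : 0 < Fintype.card ι := Fintype.card_pos
  have hy' : ∀ i, 0 < (y - x i) * (y - (x i + h)) := fun i =>
    mul_pos_of_neg_of_neg (by linarith [hy i]) (by linarith [hy i])
  set v := augmentedNodes x h y
  set w : Option (ι ⊕ ι) → ℝ := fun k => ∏ j ∈ Finset.univ.erase k, (v k - v j)
  have hwi : 0 < w (some (Sum.inr i)) := prod_augmentedNodes_inr_pos hx h0 hgap hy i
  refine ⟨(-∑ k ∈ Finset.univ.erase (some (Sum.inr i)), f (v k) / w k) * w (some (Sum.inr i)),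
    fun p hp hpx hph hpy => ?_⟩
  have hz : ∑ k, p.eval (v k) / w k = 0 := sum_eval_div_prod_eq_zero
    (by simp only [Fintype.card_option, Fintype.card_sum]; omega)
    (augmentedNodes_injective hx h0 hgap hy')
  rw [← Finset.add_sum_erase _ _ (Finset.mem_univ (some (Sum.inr i)))] at hz
  have hle : ∑ k ∈ Finset.univ.erase (some (Sum.inr i)), p.eval (v k) / w k ≤
      ∑ k ∈ Finset.univ.erase (some (Sum.inr i)), f (v k) / w k := by
    refine Finset.sum_le_sum fun k _ => ?_
    rcases k with _ | j | j
    · exact div_le_div_of_nonneg_right hpy (prod_augmentedNodes_none_pos hy').le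
    · exact (congrArg (· / w _) (hpx j)).le
    · exact div_le_div_of_nonneg_right (hph j)
        (prod_augmentedNodes_inr_pos hx h0 hgap hy j).le
  rw [← le_div_iff₀ hwi]
  change _ ≤ p.eval (v (some (Sum.inr i))) / w (some (Sum.inr i))
  linarith

lemma NConvexOn.exists_support_polynomial [Nonempty ι]
    (hf : NConvexOn (2 * Fintype.card ι - 1) (Set.Icc a b) f)
    (hx : Function.Injective x) (hxI : ∀ i, x i ∈ Set.Ioo a b) :
    ∃ p : ℝ[X], p.natDegree ≤ 2 * Fintype.card ι - 1 ∧
      (∀ i, p.eval (x i) = f (x i)) ∧ ∀ y ∈ Set.Icc a b, p.eval y ≤ f y := by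
  have hpos : 0 < Fintype.card ι := Fintype.card_pos
  have hab : a ≤ b := (hxI (Classical.arbitrary ι)).1.le.trans (hxI _).2.le
  have hdegree : ∀ {v : ι ⊕ ι → ℝ} (r : ι ⊕ ι → ℝ), Function.Injective v →
      (Lagrange.interpolate Finset.univ v r).natDegree ≤ 2 * Fintype.card ι - 1 := by
    intro v r hv
    refine natDegree_le_of_degree_le ((Lagrange.degree_interpolate_le r hv.injOn).trans ?_)
    rw [Finset.card_univ, Fintype.card_sum, two_mul]
  have hgood : ∀ᶠ h in 𝓝[>] (0 : ℝ), 0 < h ∧ (∀ i j, x i < x j → x i + h < x j) ∧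
      ∀ k, doubledNodes x h k ∈ Set.Icc a b :=
    Filter.Eventually.and self_mem_nhdsWithin
      ((eventually_translates_separated x).and (eventually_doubledNodes_mem_Icc hxI))
  obtain ⟨δ, hδ, hδgap, hδI⟩ := hgood.exists
  have hzinj := doubledNodes_injective hx hδ hδgap
  set z := doubledNodes x δ
  set q : ℝ → ℝ[X] := fun h => Lagrange.interpolate Finset.univ (doubledNodes x h)
    (fun k => f (doubledNodes x h k))
  have hqdeg : ∀ᶠ h in 𝓝[>] (0 : ℝ), (q h).natDegree ≤ 2 * Fintype.card ι - 1 := by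
    filter_upwards [hgood] with h hh
    exact hdegree _ (doubledNodes_injective hx hh.1 hh.2.1)
  have hqeval : ∀ᶠ h in 𝓝[>] (0 : ℝ), ∀ k,
      (q h).eval (doubledNodes x h k) = f (doubledNodes x h k) := by
    filter_upwards [hgood] with h hh k
    exact Lagrange.eval_interpolate_at_node _ (doubledNodes_injective hx hh.1 hh.2.1).injOn
      (Finset.mem_univ k)
  have hqle : ∀ y ∈ Set.Icc a b, (∀ i, y ≠ x i) → ∀ᶠ h in 𝓝[>] (0 : ℝ), (q h).eval y ≤ f y := by
    intro y hyI hy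
    filter_upwards [hgood, hqdeg, hqeval, eventually_forall_mul_pos hy] with h hh hd he hpos
    exact hf.eval_le_of_interpolates hx hh.1 hh.2.1 hh.2.2 hd he hyI hpos
  have hne : ∀ i j, x i + δ ≠ x j := fun i j e =>
    Sum.inr_ne_inl (hzinj (a₁ := Sum.inr i) (a₂ := Sum.inl j) e)
  choose M hM using fun i => exists_lower_bound_at_translates hx hδ hδgap
    (fun j => (hxI j).1) i f
  set U : Ultrafilter ℝ := Ultrafilter.of (𝓝[>] (0 : ℝ))
  have hUle : (U : Filter ℝ) ≤ 𝓝[>] (0 : ℝ) := Ultrafilter.of_le _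
  have hlower : ∀ᶠ h in 𝓝[>] (0 : ℝ), ∀ i, M i ≤ (q h).eval (x i + δ) := by
    have htr : ∀ᶠ h in 𝓝[>] (0 : ℝ), ∀ j, (q h).eval (x j + δ) ≤ f (x j + δ) :=
      eventually_all.2 fun j => hqle _ (hδI (Sum.inr j)) (hne j)
    filter_upwards [hqdeg, hqeval, htr,
      hqle a ⟨le_rfl, hab⟩ fun i => (hxI i).1.ne] with h hd he ht ha i
    exact hM i (q h) hd (fun j => he (Sum.inl j)) ht ha
  have hlim : ∀ i, ∃ c, Tendsto (fun h => (q h).eval (x i + δ)) U (𝓝 c) := by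
    intro i
    have hmem : Set.Icc (M i) (f (x i + δ)) ∈ U.map (fun h => (q h).eval (x i + δ)) := by
      have := (hlower.and (hqle _ (hδI (Sum.inr i)) (hne i))).filter_mono hUle
      exact this.mono fun h hh => ⟨hh.1 i, hh.2⟩
    obtain ⟨c, -, hc⟩ := isCompact_Icc.ultrafilter_le_nhds' _ hmem
    exact ⟨c, hc⟩
  choose c hc using hlim
  set r : ι ⊕ ι → ℝ := Sum.elim (fun i => f (x i)) c
  have hqlim : ∀ k, Tendsto (fun h => (q h).eval (z k)) U (𝓝 (r k)) := by
    rintro (i | i)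
    · refine tendsto_const_nhds.congr' ?_
      filter_upwards [hqeval.filter_mono hUle] with h hh
      exact (hh (Sum.inl i)).symm
    · exact hc i
  have htend : ∀ y, Tendsto (fun h => (q h).eval y) U
      (𝓝 ((Lagrange.interpolate Finset.univ z r).eval y)) := by
    intro y
    simp only [Lagrange.interpolate_apply, eval_finsetSum, eval_mul, eval_C]
    refine (tendsto_finsetSum _ fun k _ => (hqlim k).mul_const _).congr' ?_
    filter_upwards [hqdeg.filter_mono hUle] with h hd
    have hlt : (q h).degree < (Finset.univ : Finset (ι ⊕ ι)).card := by
      refine degree_le_natDegree.trans_lt ?_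
      rw [Finset.card_univ, Fintype.card_sum]
      exact_mod_cast (by omega : (q h).natDegree < Fintype.card ι + Fintype.card ι)
    conv_rhs => rw [Lagrange.eq_interpolate hzinj.injOn hlt]
    simp only [Lagrange.interpolate_apply, eval_finsetSum, eval_mul, eval_C]
  have hnode : ∀ i, (Lagrange.interpolate Finset.univ z r).eval (x i) = f (x i) := fun i =>
    Lagrange.eval_interpolate_at_node r hzinj.injOn (Finset.mem_univ (Sum.inl i))
  refine ⟨Lagrange.interpolate Finset.univ z r, hdegree _ hzinj, hnode, fun y hyI => ?_⟩
  by_cases hy : ∃ i, y = x i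
  · obtain ⟨i, rfl⟩ := hy
    exact (hnode i).le
  · push Not at hy
    exact le_of_tendsto (htend y) ((hqle y hyI hy).filter_mono hUle)

end

/-- Corollary 2: a `(2n−1)`-convex function on `[a, b]` is supported from below,
at any `n` prescribed interior points, by a polynomial of degree at most `2n−1`. -/
theorem support_below_interior_nodes
    (n : ℕ) (hn : 1 ≤ n) (a b : ℝ) (f : ℝ → ℝ)
    (hf : NConvexOn (2 * n - 1) (Set.Icc a b) f)
    (x : Fin n → ℝ) (hx : StrictMono x) (hxI : ∀ i, x i ∈ Set.Ioo a b) :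
    ∃ p : Polynomial ℝ, p.natDegree ≤ 2 * n - 1 ∧
      (∀ i, p.eval (x i) = f (x i)) ∧
      ∀ y ∈ Set.Icc a b, p.eval y ≤ f y := by
  have : Nonempty (Fin n) := ⟨⟨0, hn⟩⟩
  simpa only [Fintype.card_fin] using
    NConvexOn.exists_support_polynomial (by rwa [Fintype.card_fin]) hx.injective hxI
end

section
/- Let n ∈ ℕ, n ≥ 1. If f : [a, b] → ℝ is 2n-convex, x₁ = a, and x₂ < … < x_{n+1} are points of the open interval (a, b), then there exists a polynomial p ∈ Π_{2n} such that p(x_i) = f(x_i) for i = 1, …, n+1, and p(x) ≤ f(x) for all x ∈ [a, b]. -/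
open Polynomial in
theorem coeff_succ_mul_basisDivisor {p : ℝ[X]} {k : ℕ} (hp : p.degree < (k + 1 : ℕ)) (x y : ℝ) :
    (p * Lagrange.basisDivisor x y).coeff (k + 1) = p.coeff k / (x - y) := by
  have h : p.coeff (k + 1) = 0 := coeff_eq_zero_of_degree_lt hp
  rw [Lagrange.basisDivisor, mul_left_comm, coeff_C_mul, mul_sub, coeff_sub, coeff_mul_X,
    coeff_mul_C, h]
  ring

/-- The divided difference is the top coefficient of the interpolating polynomial. -/
theorem divDiff_eq_coeff_interpolate (f : ℝ → ℝ) (l : List ℝ) (hl : l.Nodup) :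
    divDiff f l = (Lagrange.interpolate l.toFinset id f).coeff (l.length - 1) := by
  induction l using divDiff.induct with
  | case1 => simp [divDiff]
  | case2 x => simp [divDiff]
  | case3 x y l ih₁ ih₂ =>
    obtain ⟨l', z, hz⟩ : ∃ l' z, y :: l = l' ++ [z] :=
      ⟨_, _, (List.dropLast_append_getLast (List.cons_ne_nil y l)).symm⟩
    have hlen : l'.length = l.length := by simpa using (congrArg List.length hz).symm
    rw [divDiff]
    simp only [hz, List.dropLast_concat, List.getLast_append_singleton] at *
    have hnd := hl
    simp only [List.nodup_cons, List.nodup_append, List.mem_append, List.mem_singleton,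
      not_or] at hnd
    obtain ⟨⟨hxl, hxz⟩, hl', -, hzl⟩ := hnd
    have hz' : z ∉ l' := fun h => hzl z h z rfl rfl
    rw [ih₁ (List.nodup_cons.1 hl).2, ih₂ (List.nodup_cons.2 ⟨hxl, hl'⟩)]
    have hinj : ∀ s : Finset ℝ, Set.InjOn (id : ℝ → ℝ) s := fun s => Set.injOn_id _
    rw [Lagrange.interpolate_eq_add_interpolate_erase f (hinj (x :: (l' ++ [z])).toFinset)
      (i := x) (j := z) (by simp) (by simp) hxz]
    have e₁ : (x :: (l' ++ [z])).toFinset.erase z = (x :: l').toFinset := by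
      ext t; simp; grind
    have e₂ : (x :: (l' ++ [z])).toFinset.erase x = (l' ++ [z]).toFinset := by
      ext t; simp; grind
    rw [e₁, e₂]
    have d₁ := Lagrange.degree_interpolate_lt f (hinj (x :: l').toFinset)
    have d₂ := Lagrange.degree_interpolate_lt f (hinj (l' ++ [z]).toFinset)
    rw [List.toFinset_card_of_nodup (List.nodup_cons.2 ⟨hxl, hl'⟩), List.length_cons] at d₁
    rw [List.toFinset_card_of_nodup (List.nodup_cons.1 hl).2, List.length_append,
      List.length_singleton] at d₂
    simp only [List.length_cons, List.length_append, List.length_nil, Nat.add_sub_cancel,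
      zero_add, Polynomial.coeff_add, coeff_succ_mul_basisDivisor d₁,
      coeff_succ_mul_basisDivisor d₂, id]
    have h₁ : x - z ≠ 0 := sub_ne_zero.2 hxz
    have h₂ : z - x ≠ 0 := sub_ne_zero.2 (Ne.symm hxz)
    field_simp
    ring

theorem NConvexOn.coeff_interpolate_nonneg {m : ℕ} {I : Set ℝ} {f : ℝ → ℝ}
    (hf : NConvexOn m I f) {S : Finset ℝ} (hS : S.card = m + 2) (hSI : ∀ t ∈ S, t ∈ I) :
    0 ≤ (Lagrange.interpolate S id f).coeff (m + 1) := by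
  have h := hf S.toList (by simpa using hS) S.nodup_toList (by simpa using hSI)
  rwa [divDiff_eq_coeff_interpolate _ _ S.nodup_toList, Finset.toList_toFinset,
    Finset.length_toList, hS] at h

/-- An `m`-convex function lies above its interpolating polynomial of degree at most `m` wherever
the nodal polynomial is nonnegative. -/
theorem NConvexOn.eval_interpolate_le_s5 {m : ℕ} {I : Set ℝ} {f : ℝ → ℝ} (hf : NConvexOn m I f)
    {T : Finset ℝ} (hT : T.card = m + 1) (hTI : ∀ t ∈ T, t ∈ I) {y : ℝ} (hy : y ∈ I)
    (hpos : 0 ≤ ∏ t ∈ T, (y - t)) : (Lagrange.interpolate T id f).eval y ≤ f y := by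
  have hinj : ∀ s : Finset ℝ, Set.InjOn (id : ℝ → ℝ) s := fun s => Set.injOn_id _
  have node : ∀ (s : Finset ℝ), ∀ t ∈ s, (Lagrange.interpolate s id f).eval t = f t :=
    fun s t ht => Lagrange.eval_interpolate_at_node f (hinj s) ht
  by_cases hyT : y ∈ T
  · exact (node T y hyT).le
  have hcard : (insert y T).card = m + 2 := by rw [Finset.card_insert_of_notMem hyT, hT]
  have hc := hf.coeff_interpolate_nonneg hcard (by simpa [hy] using hTI)
  set q := Lagrange.interpolate (insert y T) id f
  set p := Lagrange.interpolate T id f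
  set c := q.coeff (m + 1)
  have hdq : q.degree < (m + 2 : ℕ) := hcard ▸ Lagrange.degree_interpolate_lt f (hinj _)
  have hdp : p.degree < (m + 1 : ℕ) := hT ▸ Lagrange.degree_interpolate_lt f (hinj _)
  have hnd : (Lagrange.nodal T (id : ℝ → ℝ)).natDegree = m + 1 := by
    rw [Lagrange.natDegree_nodal, hT]
  have key : q - Polynomial.C c * Lagrange.nodal T id = p := by
    refine Polynomial.eq_of_degrees_lt_of_eval_finset_eq T ?_ (hT ▸ hdp) fun t ht => ?_
    · rw [hT, Polynomial.degree_lt_iff_coeff_zero]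
      intro k hk
      rw [Polynomial.coeff_sub, Polynomial.coeff_C_mul]
      rcases hk.eq_or_lt with rfl | hk
      · have h1 : (Lagrange.nodal T (id : ℝ → ℝ)).coeff (m + 1) = 1 := by
          rw [← hnd]; exact Lagrange.nodal_monic
        rw [h1, mul_one, sub_self]
      · rw [(Polynomial.degree_lt_iff_coeff_zero _ _).1 hdq k hk,
          Polynomial.coeff_eq_zero_of_natDegree_lt (hnd.trans_lt hk), mul_zero, sub_zero]
    · have h0 : (Lagrange.nodal T (id : ℝ → ℝ)).eval t = 0 :=
        Lagrange.eval_nodal_at_node (v := id) ht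
      rw [Polynomial.eval_sub, Polynomial.eval_mul, h0, mul_zero, sub_zero, node T t ht,
        node _ t (Finset.mem_insert_of_mem ht)]
  rw [← key, Polynomial.eval_sub, Polynomial.eval_mul, Polynomial.eval_C, Lagrange.eval_nodal,
    node _ y (Finset.mem_insert_self y T)]
  have := mul_nonneg hc hpos
  simp only [id] at *
  linarith

/-- A polynomial of degree at most `m` that is at most `f` on `m + 2` points, with equality wherever
the interpolation weight is not positive, is bounded below on these points by a bound depending
only on `f` and the points. -/
theorem sub_eval_le_of_eval_le {m : ℕ} {S X : Finset ℝ} (hS : S.card = m + 2)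
    (hpos : ∀ t ∈ S, t ∉ X → 0 < ∏ s ∈ S.erase t, (t - s)) {f : ℝ → ℝ} {p : Polynomial ℝ}
    (hp : p.natDegree ≤ m) (hpX : ∀ t ∈ X, p.eval t = f t) (hpS : ∀ t ∈ S, p.eval t ≤ f t)
    {y : ℝ} (hy : y ∈ S) :
    f y - p.eval y ≤
      |(∑ t ∈ S, f t / ∏ s ∈ S.erase t, (t - s)) * ∏ s ∈ S.erase y, (y - s)| := by
  by_cases hyX : y ∈ X
  · rw [hpX y hyX, sub_self]
    exact abs_nonneg _
  have hsum : ∑ t ∈ S, p.eval t / ∏ s ∈ S.erase t, (t - s) = 0 := by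
    have h := Lagrange.coeff_eq_sum (s := S) (v := (id : ℝ → ℝ)) (Set.injOn_id _) (P := p) (by
      rw [hS]
      exact (Polynomial.degree_le_of_natDegree_le hp).trans_lt (by exact_mod_cast (by omega)))
    rw [Polynomial.coeff_eq_zero_of_natDegree_lt (by omega)] at h
    exact h.symm
  have hle : (f y - p.eval y) / ∏ s ∈ S.erase y, (y - s) ≤
      ∑ t ∈ S, f t / ∏ s ∈ S.erase t, (t - s) := by
    rw [← sub_zero (∑ t ∈ S, f t / _), ← hsum, ← Finset.sum_sub_distrib]
    simp only [← sub_div]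
    refine Finset.single_le_sum
      (f := fun t => (f t - p.eval t) / ∏ s ∈ S.erase t, (t - s)) (fun t ht => ?_) hy
    by_cases htX : t ∈ X
    · simp [hpX t htX]
    · exact div_nonneg (sub_nonneg.2 (hpS t ht)) (hpos t ht htX).le
  exact ((div_le_iff₀ (hpos y hy hyX)).1 hle).trans (le_abs_self _)

/-- Compactness: interpolating polynomials that support `f` from below on every finite subset of `I`
yield one that supports `f` from below on `I`. -/
theorem exists_eval_le_of_forall_finset {m : ℕ} {S X : Finset ℝ} (hS : S.card = m + 2)
    (hpos : ∀ t ∈ S, t ∉ X → 0 < ∏ s ∈ S.erase t, (t - s)) {I : Set ℝ} (hSI : ∀ t ∈ S, t ∈ I)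
    {f : ℝ → ℝ}
    (h : ∀ Y : Finset ℝ, (∀ t ∈ Y, t ∈ I) → ∃ p : Polynomial ℝ, p.natDegree ≤ m ∧
      (∀ t ∈ X, p.eval t = f t) ∧ ∀ t ∈ Y, p.eval t ≤ f t) :
    ∃ p : Polynomial ℝ, p.natDegree ≤ m ∧
      (∀ t ∈ X, p.eval t = f t) ∧ ∀ t ∈ I, p.eval t ≤ f t := by
  obtain ⟨s₀, hs₀⟩ : S.Nonempty := Finset.card_pos.1 (by omega)
  set T := S.erase s₀
  have hT : T.card = m + 1 := by rw [Finset.card_erase_of_mem hs₀, hS]; rfl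
  have hinj : Set.InjOn (id : ℝ → ℝ) T := Set.injOn_id _
  set B : ℝ → ℝ := fun y =>
    |(∑ t ∈ S, f t / ∏ s ∈ S.erase t, (t - s)) * ∏ s ∈ S.erase y, (y - s)|
  set P : (ℝ → ℝ) → Polynomial ℝ := fun v => Lagrange.interpolate T id v with hP
  have hPcont : ∀ y : ℝ, Continuous fun v => (P v).eval y := fun y => by
    simp only [hP, Lagrange.interpolate_apply, Polynomial.eval_finsetSum, Polynomial.eval_mul,
      Polynomial.eval_C]
    fun_prop
  have hbox : IsCompact (Set.univ.pi fun t => Set.Icc (f t - B t) (f t)) :=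
    isCompact_univ_pi fun t => isCompact_Icc
  have hK := hbox.inter_right (isClosed_biInter (s := (X : Set ℝ))
    fun t _ => isClosed_eq (hPcont t) (continuous_const (y := f t)))
  obtain ⟨v, ⟨-, hvX⟩, hvI⟩ := hK.inter_iInter_nonempty
    (fun t : I => {v | (P v).eval (t : ℝ) ≤ f t})
    (fun t => isClosed_le (hPcont t) continuous_const) (fun u => by
      classical
      obtain ⟨p, hp, hpX, hpY⟩ := h (u.image Subtype.val ∪ S) (by
        intro t ht
        rcases Finset.mem_union.1 ht with ht | ht
        · obtain ⟨w, -, rfl⟩ := Finset.mem_image.1 ht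
          exact w.2
        · exact hSI t ht)
      have hpS : ∀ t ∈ S, p.eval t ≤ f t := fun t ht => hpY t (Finset.mem_union_right _ ht)
      have hPp : P (fun t => if t ∈ S then p.eval t else f t) = p := by
        refine (Lagrange.eq_interpolate_of_eval_eq _ hinj ?_ fun t ht => ?_).symm
        · rw [hT]
          exact (Polynomial.degree_le_of_natDegree_le hp).trans_lt (by exact_mod_cast (by omega))
        · simp [Finset.mem_of_mem_erase ht]
      refine ⟨fun t => if t ∈ S then p.eval t else f t, ⟨fun t _ => ?_, ?_⟩, ?_⟩
      · by_cases ht : t ∈ S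
        · simp only [ht, if_true]
          exact ⟨by linarith [sub_eval_le_of_eval_le hS hpos hp hpX hpS ht], hpS t ht⟩
        · simp only [ht, if_false]
          exact ⟨sub_le_self _ (abs_nonneg _), le_rfl⟩
      · simp only [Set.mem_iInter, Set.mem_ofPred_eq, hPp]
        exact fun t ht => hpX t ht
      · simp only [Set.mem_iInter, Set.mem_ofPred_eq, hPp]
        exact fun t ht => hpY t (Finset.mem_union_left _ (Finset.mem_image_of_mem _ ht)))
  simp only [Set.mem_iInter, Set.mem_ofPred_eq] at hvX hvI
  refine ⟨P v, ?_, fun t ht => hvX t ht, fun t ht => hvI ⟨t, ht⟩⟩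
  exact Polynomial.natDegree_le_of_degree_le
    ((Lagrange.degree_interpolate_le v hinj).trans (by rw [hT]; simp))

theorem exists_pos_forall_lt_add_lt (F : Finset ℝ) :
    ∃ ε > 0, ∀ s ∈ F, ∀ t ∈ F, s < t → s + ε < t := by
  have h : ∀ᶠ ε in nhdsWithin (0 : ℝ) (Set.Ioi 0), ∀ s ∈ F, ∀ t ∈ F, s < t → s + ε < t := by
    simp only [Filter.eventually_all_finset, Filter.eventually_imp_distrib_left]
    intro s _ t _ hst
    filter_upwards [Ioo_mem_nhdsGT (sub_pos.2 hst)] with ε hε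
    linarith [hε.2]
  obtain ⟨ε, hε, hpos⟩ := (h.and self_mem_nhdsWithin).exists
  exact ⟨ε, hpos, hε⟩

theorem disjoint_image_add {X : Finset ℝ} {ε : ℝ} (hε : 0 < ε)
    (hgap : ∀ s ∈ X, ∀ t ∈ X, s < t → s + ε < t) {Z : Finset ℝ} (hZ : Z ⊆ X) :
    Disjoint X (Z.image (· + ε)) := by
  rw [Finset.disjoint_right]
  intro t ht htX
  obtain ⟨s, hs, rfl⟩ := Finset.mem_image.1 ht
  exact lt_irrefl _ (hgap s (hZ hs) _ htX (by simpa using hε))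

theorem card_union_image_add {X : Finset ℝ} {ε : ℝ} (hε : 0 < ε)
    (hgap : ∀ s ∈ X, ∀ t ∈ X, s < t → s + ε < t) {Z : Finset ℝ} (hZ : Z ⊆ X) :
    (X ∪ Z.image (· + ε)).card = X.card + Z.card := by
  rw [Finset.card_union_of_disjoint (disjoint_image_add hε hgap hZ),
    Finset.card_image_of_injective _ (add_left_injective ε)]

theorem prod_sub_union_image_add_nonneg {X : Finset ℝ} {ε : ℝ} (hε : 0 < ε)
    (hgap : ∀ s ∈ X, ∀ t ∈ X, s < t → s + ε < t) {k y : ℝ} (hk : k ∈ X) (hky : k ≤ y)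
    (hy : ∀ s ∈ X.erase k, y ≤ s ∨ s + ε ≤ y) :
    0 ≤ ∏ t ∈ X ∪ (X.erase k).image (· + ε), (y - t) := by
  rw [Finset.prod_union (disjoint_image_add hε hgap (X.erase_subset k)),
    Finset.prod_image (add_left_injective ε).injOn, ← Finset.mul_prod_erase _ _ hk, mul_assoc,
    ← Finset.prod_mul_distrib]
  refine mul_nonneg (sub_nonneg.2 hky) (Finset.prod_nonneg fun s hs => ?_)
  rcases hy s hs with h | h
  · exact mul_nonneg_of_nonpos_of_nonpos (by linarith) (by linarith)
  · exact mul_nonneg (by linarith) (by linarith)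

theorem prod_sub_erase_union_image_add_pos {X : Finset ℝ} {ε : ℝ} (hε : 0 < ε)
    (hgap : ∀ s ∈ X, ∀ t ∈ X, s < t → s + ε < t) {t : ℝ}
    (ht : t ∈ X ∪ X.image (· + ε)) (htX : t ∉ X) :
    0 < ∏ s ∈ (X ∪ X.image (· + ε)).erase t, (t - s) := by
  refine lt_of_le_of_ne ?_ (Finset.prod_ne_zero_iff.2 fun s hs =>
    sub_ne_zero.2 (Finset.ne_of_mem_erase hs).symm).symm
  obtain ⟨k, hk, rfl⟩ := Finset.mem_image.1 ((Finset.mem_union.1 ht).resolve_left htX)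
  have e : (X ∪ X.image (· + ε)).erase (k + ε) = X ∪ (X.erase k).image (· + ε) := by
    ext s
    simp only [Finset.mem_erase, Finset.mem_union, Finset.mem_image]
    constructor
    · rintro ⟨hs, h | ⟨j, hj, rfl⟩⟩
      · exact Or.inl h
      · exact Or.inr ⟨j, ⟨fun h => hs (by rw [h]), hj⟩, rfl⟩
    · rintro (h | ⟨j, ⟨hjk, hj⟩, rfl⟩)
      · exact ⟨fun h' => htX (h' ▸ h), Or.inl h⟩
      · exact ⟨fun h => hjk (add_right_cancel h), Or.inr ⟨j, hj, rfl⟩⟩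
  rw [e]
  refine prod_sub_union_image_add_nonneg hε hgap hk (by linarith) fun s hs => ?_
  obtain ⟨hsk, hs⟩ := Finset.mem_erase.1 hs
  rcases lt_or_gt_of_ne hsk with h | h
  · exact Or.inr (by linarith)
  · exact Or.inl (hgap k hk s hs h).le

/-- Corollary 4: a `2n`-convex function on `[a, b]` is supported from below,
at the left endpoint `a` together with `n` prescribed interior points, by an
interpolating polynomial of degree at most `2n`. -/
theorem support_below_left_endpoint_nodes
    (n : ℕ) (hn : 1 ≤ n) (a b : ℝ) (f : ℝ → ℝ)
    (hf : NConvexOn (2 * n) (Set.Icc a b) f)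
    (x : Fin (n + 1) → ℝ) (hx : StrictMono x)
    (hxa : x ⟨0, by omega⟩ = a)
    (hxI : ∀ i : Fin (n + 1), 0 < i.val → x i ∈ Set.Ioo a b) :
    ∃ p : Polynomial ℝ, p.natDegree ≤ 2 * n ∧
      (∀ i, p.eval (x i) = f (x i)) ∧
      ∀ y ∈ Set.Icc a b, p.eval y ≤ f y := by
  have hX : ∀ t ∈ Finset.univ.image x, t = a ∨ t ∈ Set.Ioo a b := by
    intro t ht
    obtain ⟨i, -, rfl⟩ := Finset.mem_image.1 ht
    rcases Nat.eq_zero_or_pos i.val with h | h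
    · exact Or.inl (by rw [← hxa]; congr 1; exact Fin.ext h)
    · exact Or.inr (hxI i h)
  have haX : a ∈ Finset.univ.image x := Finset.mem_image.2 ⟨_, Finset.mem_univ _, hxa⟩
  have hcard : (Finset.univ.image x).card = n + 1 := by
    simp [Finset.card_image_of_injective _ hx.injective]
  have hxX : ∀ i, x i ∈ Finset.univ.image x := fun i =>
    Finset.mem_image_of_mem _ (Finset.mem_univ i)
  have hab : a < b := by
    have h := hxI ⟨1, by omega⟩ Nat.one_pos
    exact h.1.trans h.2
  set X := Finset.univ.image x
  have hXb : ∀ t ∈ X, a ≤ t ∧ t < b := fun t ht => by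
    rcases hX t ht with rfl | h
    · exact ⟨le_rfl, hab⟩
    · exact ⟨h.1.le, h.2⟩
  have hmem : ∀ {ε : ℝ}, 0 < ε → (∀ t ∈ X, t + ε < b) → ∀ t ∈ X ∪ X.image (· + ε),
      t ∈ Set.Icc a b := by
    intro ε hε hb t ht
    rcases Finset.mem_union.1 ht with h | h
    · exact ⟨(hXb t h).1, (hXb t h).2.le⟩
    · obtain ⟨s, hs, rfl⟩ := Finset.mem_image.1 h
      exact ⟨by linarith [(hXb s hs).1], (hb s hs).le⟩
  obtain ⟨ε, hε, hgap⟩ := exists_pos_forall_lt_add_lt (insert b X)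
  have hgapX : ∀ s ∈ X, ∀ t ∈ X, s < t → s + ε < t := fun s hs t ht =>
    hgap s (Finset.mem_insert_of_mem hs) t (Finset.mem_insert_of_mem ht)
  obtain ⟨p, hp, hpX, hpI⟩ := exists_eval_le_of_forall_finset (m := 2 * n)
    (S := X ∪ X.image (· + ε)) (X := X) (I := Set.Icc a b) (f := f)
    (by rw [card_union_image_add hε hgapX subset_rfl, hcard]; ring)
    (fun t ht htX => prod_sub_erase_union_image_add_pos hε hgapX ht htX)
    (hmem hε fun t ht => hgap t (Finset.mem_insert_of_mem ht) b (Finset.mem_insert_self _ _)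
      (hXb t ht).2)
    (fun Y hY => by
      obtain ⟨δ, hδ, hgap⟩ := exists_pos_forall_lt_add_lt (insert b (X ∪ Y))
      have hXF : ∀ t ∈ X, t ∈ insert b (X ∪ Y) := fun t ht =>
        Finset.mem_insert_of_mem (Finset.mem_union_left _ ht)
      have hgapX : ∀ s ∈ X, ∀ t ∈ X, s < t → s + δ < t := fun s hs t ht =>
        hgap s (hXF s hs) t (hXF t ht)
      have hTcard : (X ∪ (X.erase a).image (· + δ)).card = 2 * n + 1 := by
        rw [card_union_image_add hδ hgapX (X.erase_subset a), Finset.card_erase_of_mem haX, hcard]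
        omega
      refine ⟨Lagrange.interpolate (X ∪ (X.erase a).image (· + δ)) id f, ?_, fun t ht =>
        Lagrange.eval_interpolate_at_node f (Set.injOn_id _) (Finset.mem_union_left _ ht),
        fun y hy => ?_⟩
      · exact Polynomial.natDegree_le_of_degree_le
          ((Lagrange.degree_interpolate_le f (Set.injOn_id _)).trans (by rw [hTcard]; simp))
      · refine hf.eval_interpolate_le_s5 hTcard (fun t ht => ?_) (hY y hy)
          (prod_sub_union_image_add_nonneg hδ hgapX haX (hY y hy).1 fun s hs => ?_)
        · exact hmem hδ (fun t ht => hgap t (hXF t ht) b (Finset.mem_insert_self _ _)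
            (hXb t ht).2) t
            (Finset.union_subset_union_right (Finset.image_subset_image (X.erase_subset a)) ht)
        · rcases le_or_gt y s with h | h
          · exact Or.inl h
          · exact Or.inr (hgap s (hXF s (Finset.mem_of_mem_erase hs)) y
              (Finset.mem_insert_of_mem (Finset.mem_union_right _ hy)) h).le)
  exact ⟨p, hp, fun i => hpX _ (hxX i), hpI⟩
end
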